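/- arXiv:2201.04888 — 2 statements merged into one kernel-verified Lean document; each statement's English description precedes it below -/
import Mathlib

section
/- A sequence k_1 ≥ k_2 ≥ ... ≥ k_n of nonnegative integers with even sum is the degree sequence of some simple graph on n labelled vertices if and only if for every p ∈ [n], the sum of the p largest entries satisfies ∑_{j=1}^p k_j ≤ p(p-1) + ∑_{j=p+1}^n min(k_j, p). -/
open scoped Classical

namespace EG

/-- The degree of a vertex, with a fixed choice of instances. -/
noncomputable def dg {n : ℕ} (G : SimpleGraph (Fin n)) (x : Fin n) : ℕ :=
  (Finset.univ.filter (fun y => G.Adj x y)).card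

lemma degree_eq_dg {n : ℕ} (G : SimpleGraph (Fin n)) (x : Fin n)
    [inst : Fintype (G.neighborSet x)] : G.degree x = dg G x := by
  unfold dg
  rw [← SimpleGraph.card_neighborFinset_eq_degree]
  congr 1
  ext y
  simp

lemma even_sum {n : ℕ} (G : SimpleGraph (Fin n)) : Even (∑ x, dg G x) := by
  have h := G.sum_degrees_eq_twice_card_edges
  simp only [degree_eq_dg] at h
  rw [h]
  exact even_two_mul _

lemma add_edge {n : ℕ} (G : SimpleGraph (Fin n)) (u v : Fin n) (huv : u ≠ v)
    (h : ¬ G.Adj u v) : ∃ G' : SimpleGraph (Fin n),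
      (∀ a b, G'.Adj a b ↔ G.Adj a b ∨ (a = u ∧ b = v) ∨ (a = v ∧ b = u)) ∧
      ∀ x, dg G' x = dg G x + (if x = u then 1 else 0) + (if x = v then 1 else 0) := by
  refine ⟨⟨fun a b => G.Adj a b ∨ (a = u ∧ b = v) ∨ (a = v ∧ b = u), ?_, ?_⟩, ?_, ?_⟩
  · constructor
    intro a b hab
    have := G.adj_comm a b
    tauto
  · constructor
    intro a ha
    rcases ha with ha | ha | ha
    · exact G.loopless.irrefl a ha
    · exact huv (ha.1.symm.trans ha.2)
    · exact huv (ha.2.symm.trans ha.1)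
  · intro a b; rfl
  · intro x
    have h' : ¬ G.Adj v u := fun h1 => h h1.symm
    unfold dg
    by_cases hu : x = u
    · subst hu
      trans (insert v (Finset.univ.filter (fun y => G.Adj x y))).card
      · congr 1; ext y; simp [huv]; tauto
      rw [Finset.card_insert_of_notMem (by simpa using h)]
      simp [huv]
    · by_cases hv : x = v
      · subst hv
        trans (insert u (Finset.univ.filter (fun y => G.Adj x y))).card
        · congr 1; ext y; simp [hu]; tauto
        rw [Finset.card_insert_of_notMem (by simpa using h')]
        simp [hu]
      · simp [hu, hv]

lemma del_edge {n : ℕ} (G : SimpleGraph (Fin n)) (u v : Fin n)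
    (h : G.Adj u v) : ∃ G' : SimpleGraph (Fin n),
      (∀ a b, G'.Adj a b ↔ G.Adj a b ∧ ¬ (a = u ∧ b = v) ∧ ¬ (a = v ∧ b = u)) ∧
      ∀ x, dg G' x + (if x = u then 1 else 0) + (if x = v then 1 else 0) = dg G x := by
  let G' : SimpleGraph (Fin n) :=
    ⟨fun a b => G.Adj a b ∧ ¬ (a = u ∧ b = v) ∧ ¬ (a = v ∧ b = u), by
      constructor
      intro a b hab
      have := G.adj_comm a b
      tauto, ⟨fun a ha => G.loopless.irrefl a ha.1⟩⟩
  have hG' : ∀ a b, G'.Adj a b ↔ G.Adj a b ∧ ¬ (a = u ∧ b = v) ∧ ¬ (a = v ∧ b = u) :=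
    fun a b => Iff.rfl
  refine ⟨G', hG', ?_⟩
  have huv : u ≠ v := h.ne
  obtain ⟨G'', h1, h2⟩ := add_edge G' u v huv (by rw [hG']; tauto)
  have : G'' = G := by
    ext a b
    rw [h1, hG']
    constructor
    · rintro (h3 | ⟨rfl, rfl⟩ | ⟨rfl, rfl⟩)
      · exact h3.1
      · exact h
      · exact h.symm
    · tauto
  intro x
  rw [← this, h2]

lemma exists_nbr {n : ℕ} (G : SimpleGraph (Fin n)) (i r : Fin n) (h : dg G r < dg G i) :
    ∃ u, G.Adj i u ∧ u ≠ r ∧ ¬ G.Adj r u ∧ u ≠ i := by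
  by_contra! hc
  have hsub : (Finset.univ.filter (fun y => G.Adj i y)).erase r ⊆
      (Finset.univ.filter (fun y => G.Adj r y)).erase i := by
    intro y hy
    simp only [Finset.mem_erase, Finset.mem_filter, Finset.mem_univ, true_and] at hy ⊢
    refine ⟨hy.2.ne', ?_⟩
    by_contra h1
    exact hy.2.ne' (hc y hy.2 hy.1 h1)
  have hcard := Finset.card_le_card hsub
  unfold dg at h
  rw [Finset.card_erase_eq_ite, Finset.card_erase_eq_ite] at hcard
  simp only [Finset.mem_filter, Finset.mem_univ, true_and, G.adj_comm i r] at hcard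
  split_ifs at hcard with h1
  · have : 0 < (Finset.univ.filter (fun y => G.Adj r y)).card :=
      Finset.card_pos.2 ⟨i, by simpa using h1⟩
    omega
  · omega

/-- Degree sum over an initial segment, split by inside and outside. -/
lemma sum_split {n : ℕ} (G : SimpleGraph (Fin n)) (p : ℕ) :
    ∑ j ∈ Finset.univ.filter (fun j : Fin n => (j : ℕ) < p), dg G j =
      ∑ j ∈ Finset.univ.filter (fun j : Fin n => (j : ℕ) < p),
        (Finset.univ.filter (fun y : Fin n => G.Adj j y ∧ (y : ℕ) < p)).card +
      ∑ j ∈ Finset.univ.filter (fun j : Fin n => p ≤ (j : ℕ)),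
        (Finset.univ.filter (fun y : Fin n => G.Adj j y ∧ (y : ℕ) < p)).card := by
  have h1 : ∀ j : Fin n, dg G j =
      (Finset.univ.filter (fun y : Fin n => G.Adj j y ∧ (y : ℕ) < p)).card +
      (Finset.univ.filter (fun y : Fin n => G.Adj j y ∧ p ≤ (y : ℕ))).card := by
    intro j
    unfold dg
    rw [← Finset.card_filter_add_card_filter_not (fun y : Fin n => (y : ℕ) < p)]
    simp only [Finset.filter_filter, not_lt]
  simp only [h1, Finset.sum_add_distrib]
  congr 1
  have h2 : ∀ j : Fin n, (Finset.univ.filter (fun y : Fin n => G.Adj j y ∧ p ≤ (y : ℕ))).card =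
      ∑ y ∈ Finset.univ.filter (fun y : Fin n => p ≤ (y : ℕ)), if G.Adj j y then 1 else 0 := by
    intro j
    rw [← Finset.card_filter, Finset.filter_filter]
    simp only [and_comm]
  have h3 : ∀ j : Fin n, (Finset.univ.filter (fun y : Fin n => G.Adj j y ∧ (y : ℕ) < p)).card =
      ∑ y ∈ Finset.univ.filter (fun y : Fin n => (y : ℕ) < p), if G.Adj j y then 1 else 0 := by
    intro j
    rw [← Finset.card_filter, Finset.filter_filter]
    simp only [and_comm]
  simp only [h2, h3]
  rw [Finset.sum_comm]
  simp only [G.adj_comm]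

lemma card_lt {n : ℕ} (p : ℕ) (hp : p ≤ n) :
    (Finset.univ.filter (fun j : Fin n => (j : ℕ) < p)).card = p := by
  rw [Fin.card_filter_val_lt]
  omega

lemma necessity {n : ℕ} (G : SimpleGraph (Fin n)) (p : ℕ) (hp : p ≤ n) :
    ∑ j ∈ Finset.univ.filter (fun j : Fin n => (j : ℕ) < p), dg G j ≤
      p * (p - 1) +
        ∑ j ∈ Finset.univ.filter (fun j : Fin n => p ≤ (j : ℕ)), min (dg G j) p := by
  rw [sum_split]
  apply add_le_add
  · calc _ ≤ ∑ j ∈ Finset.univ.filter (fun j : Fin n => (j : ℕ) < p), (p - 1) := by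
          apply Finset.sum_le_sum
          intro j hj
          rw [← card_lt p hp, ← Finset.card_erase_of_mem hj, card_lt p hp]
          apply Finset.card_le_card
          intro y hy
          simp only [Finset.mem_erase, Finset.mem_filter, Finset.mem_univ, true_and] at hy ⊢
          exact ⟨hy.1.ne', hy.2⟩
      _ = _ := by rw [Finset.sum_const, card_lt p hp, smul_eq_mul]
  · apply Finset.sum_le_sum
    intro j hj
    apply le_min
    · apply Finset.card_le_card
      intro y hy
      simp only [Finset.mem_filter, Finset.mem_univ, true_and] at hy ⊢
      exact hy.1
    · conv_rhs => rw [← card_lt p hp]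
      apply Finset.card_le_card
      intro y hy
      simp only [Finset.mem_filter, Finset.mem_univ, true_and] at hy ⊢
      exact hy.2

/-- Subrealization invariant with critical index `r`. -/
def Inv {n : ℕ} (k : Fin n → ℕ) (r : Fin n) (G : SimpleGraph (Fin n)) : Prop :=
  (∀ x, dg G x ≤ k x) ∧ (∀ x, x < r → dg G x = k x) ∧
    ∀ x y, G.Adj x y → x ≤ r ∨ y ≤ r

lemma step {n : ℕ} (k : Fin n → ℕ)
    (hmono : ∀ i j : Fin n, i ≤ j → k j ≤ k i)
    (heven : Even (∑ j, k j)) (r : Fin n)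
    (hEG : ∑ j ∈ Finset.univ.filter (fun j : Fin n => (j : ℕ) < r + 1), k j ≤
          (r + 1) * (r + 1 - 1) +
            ∑ j ∈ Finset.univ.filter (fun j : Fin n => r + 1 ≤ (j : ℕ)), min (k j) (r + 1))
    (G : SimpleGraph (Fin n)) (hI : Inv k r G) (hr : dg G r < k r) :
    ∃ G', Inv k r G' ∧ dg G r < dg G' r := by
  obtain ⟨hle, heq, hind⟩ := hI
  have hirr : ∀ x, ¬ G.Adj x x := fun x => G.loopless.irrefl x
  have hsymm : ∀ x y, G.Adj x y → G.Adj y x := fun x y h => h.symm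
  have hbig : ∀ i, i < r → dg G r < dg G i := by
    intro i hi
    have := hmono i r hi.le
    rw [heq i hi]; omega
  -- Case 0
  by_cases c0 : ∃ i, r < i ∧ ¬ G.Adj r i ∧ dg G i < k i
  · obtain ⟨i, hi, hadj, hd⟩ := c0
    obtain ⟨G', hA, hD⟩ := add_edge G r i hi.ne hadj
    refine ⟨G', ⟨?_, ?_, ?_⟩, ?_⟩
    · intro x
      have := hle x
      rw [hD]; split_ifs <;> (try subst_vars) <;> omega
    · intro x hx
      rw [hD, if_neg (by omega), if_neg (by omega), heq x hx]; rfl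
    · intro x y hxy
      rw [hA] at hxy
      rcases hxy with h | ⟨rfl, rfl⟩ | ⟨rfl, rfl⟩
      · exact hind x y h
      · exact Or.inl le_rfl
      · exact Or.inr le_rfl
    · rw [hD, if_pos rfl]; omega
  push Not at c0
  -- Case 1
  by_cases c1 : ∃ i, i < r ∧ ¬ G.Adj r i
  · obtain ⟨i, hi, hadj⟩ := c1
    obtain ⟨u, hiu, hur, hru, hui⟩ := exists_nbr G i r (hbig i hi)
    obtain ⟨G1, hA1, hD1⟩ := del_edge G i u hiu
    obtain ⟨G2, hA2, hD2⟩ := add_edge G1 r u (Ne.symm hur) (by rw [hA1]; tauto)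
    obtain ⟨G3, hA3, hD3⟩ := add_edge G2 r i hi.ne' (by rw [hA2, hA1]; grind)
    have hD : ∀ x, dg G3 x = dg G x + if x = r then 2 else 0 := by
      intro x
      have e1 := hD1 x
      have e2 := hD2 x
      have e3 := hD3 x
      grind
    have hind3 : ∀ x y, G3.Adj x y → x ≤ r ∨ y ≤ r := by
      intro x y hxy
      rw [hA3, hA2, hA1] at hxy
      have := hind x y
      grind
    by_cases h2 : dg G r + 2 ≤ k r
    · refine ⟨G3, ⟨?_, ?_, hind3⟩, ?_⟩
      · intro x
        have := hle x
        rw [hD]; split_ifs <;> (try subst_vars) <;> omega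
      · intro x hx
        rw [hD, if_neg (by omega), heq x hx]; rfl
      · rw [hD]; simp
    · have hk : ∃ t, r < t ∧ dg G t < k t := by
        by_contra! hc
        have hs : ∑ x, k x = ∑ x, dg G x + 1 := by
          have : ∀ x, k x = dg G x + if x = r then 1 else 0 := by
            intro x
            split_ifs with hx
            · subst hx; omega
            · rcases lt_or_gt_of_ne hx with h | h
              · rw [heq x h]; rfl
              · have := hc x h
                have := hle x
                omega
          simp only [this, Finset.sum_add_distrib]
          simp
        have he := even_sum G
        rw [hs] at heven
        rw [Nat.even_add_one] at heven
        exact heven he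
      obtain ⟨t, ht, hdt⟩ := hk
      have hrt : G.Adj r t := by
        by_contra h
        have := c0 t ht h
        omega
      obtain ⟨G4, hA4, hD4⟩ := del_edge G3 r t (by rw [hA3, hA2, hA1]; grind)
      refine ⟨G4, ⟨?_, ?_, ?_⟩, ?_⟩
      · intro x
        have e1 := hle x
        have e2 := hD x
        have e3 := hD4 x
        grind
      · intro x hx
        have e1 := heq x hx
        have e2 := hD x
        have e3 := hD4 x
        grind
      · intro x y hxy
        rw [hA4] at hxy
        exact hind3 x y hxy.1
      · have e2 := hD r
        have e3 := hD4 r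
        grind
  push Not at c1
  -- Case 2
  by_cases c2 : ∃ t, r < t ∧ dg G t < k t ∧ dg G t < r + 1
  · obtain ⟨t, ht, hdt, hdt2⟩ := c2
    have hrt : G.Adj r t := by
      by_contra h
      have := c0 t ht h
      omega
    have hi : ∃ i, i < r ∧ ¬ G.Adj t i := by
      by_contra! hc
      have : (Finset.univ.filter (fun j : Fin n => (j : ℕ) < r + 1)).card ≤ dg G t := by
        apply Finset.card_le_card
        intro y hy
        simp only [Finset.mem_filter, Finset.mem_univ, true_and] at hy ⊢
        by_cases hyr : y = r
        · rw [hyr]; exact hrt.symm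
        · exact hc y (by omega)
      rw [card_lt _ (by omega)] at this
      omega
    obtain ⟨i, hi, hti⟩ := hi
    obtain ⟨u, hiu, hur, hru, hui⟩ := exists_nbr G i r (hbig i hi)
    have hu : r < u := by
      by_contra h
      exact hru (c1 u (by omega))
    have hut : u ≠ t := by rintro rfl; exact hru hrt
    obtain ⟨G1, hA1, hD1⟩ := del_edge G i u hiu
    obtain ⟨G2, hA2, hD2⟩ := add_edge G1 r u (Ne.symm hur) (by rw [hA1]; tauto)
    obtain ⟨G3, hA3, hD3⟩ := add_edge G2 t i (by omega) (by rw [hA2, hA1]; grind)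
    have hD : ∀ x, dg G3 x = dg G x + (if x = r then 1 else 0) + (if x = t then 1 else 0) := by
      intro x
      have e1 := hD1 x
      have e2 := hD2 x
      have e3 := hD3 x
      grind
    refine ⟨G3, ⟨?_, ?_, ?_⟩, ?_⟩
    · intro x
      have e1 := hle x
      have e2 := hD x
      grind
    · intro x hx
      have e1 := heq x hx
      have e2 := hD x
      grind
    · intro x y hxy
      rw [hA3, hA2, hA1] at hxy
      have := hind x y
      grind
    · have e2 := hD r
      grind
  push Not at c2
  -- Case 3
  by_cases c3 : ∃ i j, i < r ∧ j < r ∧ i ≠ j ∧ ¬ G.Adj i j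
  · obtain ⟨i, j, hi, hj, hij, hadj⟩ := c3
    obtain ⟨u, hiu, hur, hru, hui⟩ := exists_nbr G i r (hbig i hi)
    obtain ⟨w, hjw, hwr, hrw, hwj⟩ := exists_nbr G j r (hbig j hj)
    have hu : r < u := by
      by_contra h
      exact hru (c1 u (by omega))
    have hw : r < w := by
      by_contra h
      exact hrw (c1 w (by omega))
    obtain ⟨G1, hA1, hD1⟩ := del_edge G i u hiu
    obtain ⟨G2, hA2, hD2⟩ := del_edge G1 j w (by rw [hA1]; grind)
    obtain ⟨G3, hA3, hD3⟩ := add_edge G2 r u (Ne.symm hur) (by rw [hA2, hA1]; tauto)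
    obtain ⟨G4, hA4, hD4⟩ := add_edge G3 i j hij (by rw [hA3, hA2, hA1]; grind)
    have hD : ∀ x, dg G4 x + (if x = w then 1 else 0) = dg G x + (if x = r then 1 else 0) := by
      intro x
      have e1 := hD1 x
      have e2 := hD2 x
      have e3 := hD3 x
      have e4 := hD4 x
      omega
    refine ⟨G4, ⟨?_, ?_, ?_⟩, ?_⟩
    · intro x
      have e1 := hle x
      have e2 := hD x
      grind
    · intro x hx
      have e1 := heq x hx
      have e2 := hD x
      grind
    · intro x y hxy
      rw [hA4, hA3, hA2, hA1] at hxy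
      have := hind x y
      grind
    · have e2 := hD r
      grind
  push Not at c3
  -- Final contradiction
  exfalso
  have hcomp : ∀ i j : Fin n, i ≤ r → j ≤ r → i ≠ j → G.Adj i j := by
    intro i j hi hj hij
    by_cases h1 : i = r
    · subst h1; exact c1 j (by omega)
    · by_cases h2 : j = r
      · subst h2; exact (c1 i (by omega)).symm
      · exact c3 i j (by omega) (by omega) hij
  have hsp := sum_split G (r + 1)
  have hS1 : ∑ j ∈ Finset.univ.filter (fun j : Fin n => (j : ℕ) < r + 1),
      (Finset.univ.filter (fun y : Fin n => G.Adj j y ∧ (y : ℕ) < r + 1)).card =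
      (r + 1) * (r + 1 - 1) := by
    calc _ = ∑ j ∈ Finset.univ.filter (fun j : Fin n => (j : ℕ) < r + 1), (r + 1 - 1 : ℕ) := by
          apply Finset.sum_congr rfl
          intro j hj
          have hc := Finset.card_erase_of_mem hj
          rw [card_lt _ (by omega)] at hc
          rw [← hc]
          congr 1
          ext y
          simp only [Finset.mem_erase, Finset.mem_filter, Finset.mem_univ, true_and] at hj ⊢
          constructor
          · intro h; exact ⟨h.1.ne', h.2⟩
          · intro h; exact ⟨hcomp j y (by omega) (by omega) (Ne.symm h.1), h.2⟩
      _ = _ := by rw [Finset.sum_const, card_lt _ (by omega), smul_eq_mul]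
  have hS2 : ∑ j ∈ Finset.univ.filter (fun j : Fin n => r + 1 ≤ (j : ℕ)), min (k j) (r + 1) ≤
      ∑ j ∈ Finset.univ.filter (fun j : Fin n => r + 1 ≤ (j : ℕ)),
      (Finset.univ.filter (fun y : Fin n => G.Adj j y ∧ (y : ℕ) < r + 1)).card := by
    apply Finset.sum_le_sum
    intro j hj
    simp only [Finset.mem_filter, Finset.mem_univ, true_and] at hj
    have h1 : (Finset.univ.filter (fun y : Fin n => G.Adj j y ∧ (y : ℕ) < r + 1)).card
        = dg G j := by
      unfold dg
      congr 1
      ext y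
      simp only [Finset.mem_filter, Finset.mem_univ, true_and]
      constructor
      · exact fun h => h.1
      · intro h
        refine ⟨h, ?_⟩
        have := hind j y h
        omega
    rw [h1]
    have := c2 j (by omega)
    by_cases h : dg G j < k j
    · exact (min_le_right _ _).trans (this h)
    · exact (min_le_left _ _).trans (not_lt.1 h)
  have hlt : ∑ j ∈ Finset.univ.filter (fun j : Fin n => (j : ℕ) < r + 1), dg G j <
      ∑ j ∈ Finset.univ.filter (fun j : Fin n => (j : ℕ) < r + 1), k j := by
    apply Finset.sum_lt_sum (fun x _ => hle x)
    exact ⟨r, by simp, hr⟩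
  omega

lemma fill {n : ℕ} (k : Fin n → ℕ)
    (hmono : ∀ i j : Fin n, i ≤ j → k j ≤ k i)
    (heven : Even (∑ j, k j)) (r : Fin n)
    (hEG : ∑ j ∈ Finset.univ.filter (fun j : Fin n => (j : ℕ) < r + 1), k j ≤
          (r + 1) * (r + 1 - 1) +
            ∑ j ∈ Finset.univ.filter (fun j : Fin n => r + 1 ≤ (j : ℕ)), min (k j) (r + 1))
    (d : ℕ) : ∀ (G : SimpleGraph (Fin n)), Inv k r G → k r - dg G r ≤ d →
    ∃ G', Inv k r G' ∧ dg G' r = k r := by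
  induction d with
  | zero =>
    intro G hG hd
    have := hG.1 r
    exact ⟨G, hG, by omega⟩
  | succ d ih =>
    intro G hG hd
    by_cases h : dg G r < k r
    · obtain ⟨G', hG', hlt⟩ := step k hmono heven r hEG G hG h
      exact ih G' hG' (by omega)
    · have := hG.1 r
      exact ⟨G, hG, by omega⟩

end EG

/-- **Erdős–Gallai theorem.** A nonincreasing sequence `k` of nonnegative integers with
even sum is the degree sequence of a simple graph on `n` labelled vertices iff for every
`p ∈ [n]`, `∑_{j=1}^p k_j ≤ p(p-1) + ∑_{j=p+1}^n min(k_j, p)`. -/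
theorem erdos_gallai (n : ℕ) (k : Fin n → ℕ)
    (hmono : ∀ i j : Fin n, i ≤ j → k j ≤ k i)
    (heven : Even (∑ j, k j)) :
    (∃ G : SimpleGraph (Fin n), ∀ j, G.degree j = k j) ↔
      ∀ p : ℕ, 1 ≤ p → p ≤ n →
        ∑ j ∈ Finset.univ.filter (fun j : Fin n => (j : ℕ) < p), k j ≤
          p * (p - 1) +
            ∑ j ∈ Finset.univ.filter (fun j : Fin n => p ≤ (j : ℕ)), min (k j) p := by
  simp only [EG.degree_eq_dg]
  constructor
  · rintro ⟨G, hG⟩ p _ hp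
    have := EG.necessity G p hp
    simpa only [hG] using this
  · intro hEG
    have key : ∀ r : ℕ, r ≤ n → ∃ G : SimpleGraph (Fin n), (∀ x, EG.dg G x ≤ k x) ∧
        (∀ x : Fin n, (x : ℕ) < r → EG.dg G x = k x) ∧
        ∀ x y : Fin n, G.Adj x y → (x : ℕ) < r ∨ (y : ℕ) < r := by
      intro r
      induction r with
      | zero =>
        intro _
        refine ⟨⊥, ?_, ?_, ?_⟩
        · intro x; simp [EG.dg]
        · intro x hx; omega
        · intro x y hxy; exact absurd hxy (by simp)
      | succ r ih =>
        intro hr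
        obtain ⟨G, h1, h2, h3⟩ := ih (by omega)
        obtain ⟨G', ⟨a1, a2, a3⟩, a4⟩ := EG.fill k hmono heven ⟨r, by omega⟩
          (hEG (r + 1) (by omega) hr) _ G
          ⟨h1, fun x hx => h2 x hx, fun x y hxy => (h3 x y hxy).imp
            (fun h => le_of_lt (Fin.lt_def.2 h)) (fun h => le_of_lt (Fin.lt_def.2 h))⟩ le_rfl
        refine ⟨G', a1, ?_, ?_⟩
        · intro x hx
          by_cases hxr : (x : ℕ) = r
          · have : x = ⟨r, by omega⟩ := Fin.ext hxr
            rw [this]; exact a4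
          · exact a2 x (Fin.lt_def.2 (by simp only; omega))
        · intro x y hxy
          have := a3 x y hxy
          simp only [Fin.le_def] at this
          omega
    obtain ⟨G, _, h2, _⟩ := key n le_rfl
    exact ⟨G, fun j => h2 j j.2⟩
end

section
/- Taylor's theorem: the set of connected simple graphs with a fixed graphical degree sequence k is connected under switch operations that preserve connectivity. That is, for any two connected graphs G, G' ∈ G(k), there is a sequence of switches transforming G into G' such that every intermediate graph is connected and has degree sequence k. -/
open scoped Classical

/-- A switch: delete two disjoint edges `{a,b}`, `{c,d}` and insert the non-edges
`{a,c}`, `{b,d}`.  Switches preserve the degree sequence. -/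
def SwitchMove {n : ℕ} (G H : SimpleGraph (Fin n)) : Prop :=
  ∃ a b c d : Fin n, a ≠ b ∧ a ≠ c ∧ a ≠ d ∧ b ≠ c ∧ b ≠ d ∧ c ≠ d ∧
    G.Adj a b ∧ G.Adj c d ∧ ¬ G.Adj a c ∧ ¬ G.Adj b d ∧
    H.edgeSet = (G.edgeSet \ {s(a, b), s(c, d)}) ∪ {s(a, c), s(b, d)}

namespace Taylor

variable {n : ℕ}

/-- Neighbours as a finset. -/
noncomputable def nb (G : SimpleGraph (Fin n)) (v : Fin n) : Finset (Fin n) :=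
  Finset.univ.filter (fun w => G.Adj v w)

lemma mem_nb (G : SimpleGraph (Fin n)) (v w : Fin n) : w ∈ nb G v ↔ G.Adj v w := by
  simp [nb]

lemma degree_eq (G : SimpleGraph (Fin n)) (v : Fin n) : G.degree v = (nb G v).card := by
  rw [← SimpleGraph.card_neighborFinset_eq_degree]
  congr 1
  ext w
  simp [mem_nb]

/-- Delete all edges at `v`. -/
def del (G : SimpleGraph (Fin n)) (v : Fin n) : SimpleGraph (Fin n) where
  Adj x y := G.Adj x y ∧ x ≠ v ∧ y ≠ v
  symm := ⟨fun _ _ h => ⟨h.1.symm, h.2.2, h.2.1⟩⟩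
  loopless := ⟨fun _ h => h.1.ne rfl⟩

lemma del_adj (G : SimpleGraph (Fin n)) (v x y : Fin n) :
    (del G v).Adj x y ↔ G.Adj x y ∧ x ≠ v ∧ y ≠ v := Iff.rfl

/-- Remove the edge `x y`. -/
def rem (G : SimpleGraph (Fin n)) (a b : Fin n) : SimpleGraph (Fin n) where
  Adj x y := G.Adj x y ∧ ¬ (x = a ∧ y = b) ∧ ¬ (x = b ∧ y = a)
  symm := ⟨fun _ _ h => ⟨h.1.symm, by tauto, by tauto⟩⟩
  loopless := ⟨fun _ h => h.1.ne rfl⟩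

lemma rem_adj (G : SimpleGraph (Fin n)) (a b x y : Fin n) :
    (rem G a b).Adj x y ↔ G.Adj x y ∧ ¬ (x = a ∧ y = b) ∧ ¬ (x = b ∧ y = a) := Iff.rfl

/-- Adjacency after a switch. -/
def SwAdj (G : SimpleGraph (Fin n)) (a b c d x y : Fin n) : Prop :=
  (G.Adj x y ∧ ¬ (x = a ∧ y = b) ∧ ¬ (x = b ∧ y = a) ∧ ¬ (x = c ∧ y = d) ∧ ¬ (x = d ∧ y = c)) ∨
    (x = a ∧ y = c) ∨ (x = c ∧ y = a) ∨ (x = b ∧ y = d) ∨ (x = d ∧ y = b)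

lemma switch_iff (G H : SimpleGraph (Fin n)) : SwitchMove G H ↔
    ∃ a b c d : Fin n, a ≠ b ∧ a ≠ c ∧ a ≠ d ∧ b ≠ c ∧ b ≠ d ∧ c ≠ d ∧
    G.Adj a b ∧ G.Adj c d ∧ ¬ G.Adj a c ∧ ¬ G.Adj b d ∧
    ∀ x y, H.Adj x y ↔ SwAdj G a b c d x y := by
  unfold SwitchMove
  refine exists_congr fun a => exists_congr fun b => exists_congr fun c => exists_congr fun d => ?_
  have key : H.edgeSet = (G.edgeSet \ {s(a, b), s(c, d)}) ∪ {s(a, c), s(b, d)} ↔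
      ∀ x y, H.Adj x y ↔ SwAdj G a b c d x y := by
    rw [Set.ext_iff, Sym2.forall]
    refine forall_congr' fun x => forall_congr' fun y => ?_
    simp only [SimpleGraph.mem_edgeSet, Set.mem_union, Set.mem_sdiff, Set.mem_insert_iff,
      Set.mem_singleton_iff, Sym2.eq_iff, SwAdj]
    refine iff_congr Iff.rfl ?_
    grind
  rw [key]

/-- The switched graph. -/
def sw (G : SimpleGraph (Fin n)) (a b c d : Fin n) (h1 : a ≠ c) (h2 : b ≠ d) :
    SimpleGraph (Fin n) where
  Adj x y := SwAdj G a b c d x y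
  symm := ⟨fun x y h => by
    unfold SwAdj at h ⊢
    rw [G.adj_comm y x]
    grind⟩
  loopless := ⟨fun x h => by
    unfold SwAdj at h
    have := G.irrefl (v := x)
    grind⟩

lemma switch_symm {G H : SimpleGraph (Fin n)} (h : SwitchMove G H) : SwitchMove H G := by
  rw [switch_iff] at h ⊢
  obtain ⟨a, b, c, d, hab, hac, had, hbc, hbd, hcd, e1, e2, e3, e4, h⟩ := h
  refine ⟨a, c, b, d, hac, hab, had, hbc.symm, hcd, hbd, ?_, ?_, ?_, ?_, ?_⟩
  · rw [h]; unfold SwAdj; tauto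
  · rw [h]; unfold SwAdj; tauto
  · rw [h]; unfold SwAdj; grind
  · rw [h]; unfold SwAdj; grind
  · intro x y
    unfold SwAdj
    rw [h]
    unfold SwAdj
    have e1' := e1.symm
    have e2' := e2.symm
    have e3' : ¬ G.Adj c a := fun h => e3 h.symm
    have e4' : ¬ G.Adj d b := fun h => e4 h.symm
    grind

lemma switch_card {G H : SimpleGraph (Fin n)} (h : SwitchMove G H) (j : Fin n) :
    (nb H j).card = (nb G j).card := by
  rw [switch_iff] at h
  obtain ⟨a, b, c, d, hab, hac, had, hbc, hbd, hcd, e1, e2, e3, e4, h⟩ := h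
  have e1' := e1.symm
  have e2' := e2.symm
  have e3' : ¬ G.Adj c a := fun h => e3 h.symm
  have e4' : ¬ G.Adj d b := fun h => e4 h.symm
  have gen : ∀ p q, G.Adj j p → ¬ G.Adj j q → nb H j = insert q ((nb G j).erase p) →
      (nb H j).card = (nb G j).card := by
    intro p q hp hq he
    rw [he, Finset.card_insert_of_notMem, Finset.card_erase_of_mem]
    · have : 0 < (nb G j).card := Finset.card_pos.2 ⟨p, (mem_nb ..).2 hp⟩
      omega
    · exact (mem_nb ..).2 hp
    · intro hh
      exact hq ((mem_nb ..).1 (Finset.mem_of_mem_erase hh))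
  by_cases ja : j = a
  · subst ja
    refine gen b c e1 e3 ?_
    ext x
    simp only [mem_nb, h, SwAdj, Finset.mem_insert, Finset.mem_erase]
    grind
  by_cases jb : j = b
  · subst jb
    refine gen a d e1' e4 ?_
    ext x
    simp only [mem_nb, h, SwAdj, Finset.mem_insert, Finset.mem_erase]
    grind
  by_cases jc : j = c
  · subst jc
    refine gen d a e2 e3' ?_
    ext x
    simp only [mem_nb, h, SwAdj, Finset.mem_insert, Finset.mem_erase]
    grind
  by_cases jd : j = d
  · subst jd
    refine gen c b e2' e4' ?_
    ext x
    simp only [mem_nb, h, SwAdj, Finset.mem_insert, Finset.mem_erase]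
    grind
  congr 1
  ext x
  simp only [mem_nb, h, SwAdj]
  grind

/-- All edges lie inside `S`. -/
def Supp (S : Finset (Fin n)) (G : SimpleGraph (Fin n)) : Prop :=
  ∀ x y, G.Adj x y → x ∈ S

lemma switch_supp {S : Finset (Fin n)} {G H : SimpleGraph (Fin n)} (h : SwitchMove G H)
    (hS : Supp S G) : Supp S H := by
  rw [switch_iff] at h
  obtain ⟨a, b, c, d, hab, hac, had, hbc, hbd, hcd, e1, e2, e3, e4, h⟩ := h
  have := hS _ _ e1
  have := hS _ _ e1.symm
  have := hS _ _ e2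
  have := hS _ _ e2.symm
  intro x y hxy
  rw [h] at hxy
  unfold SwAdj at hxy
  have := hS x y
  grind

/-- Connected on `S`. -/
def ConnOn (S : Finset (Fin n)) (G : SimpleGraph (Fin n)) : Prop :=
  ∀ x ∈ S, ∀ y ∈ S, G.Reachable x y

/-- One connectivity preserving switch. -/
def R (S : Finset (Fin n)) (G H : SimpleGraph (Fin n)) : Prop :=
  SwitchMove G H ∧ ConnOn S G ∧ ConnOn S H

/-- Sequences of switches. -/
def T (S : Finset (Fin n)) (G H : SimpleGraph (Fin n)) : Prop :=
  Relation.ReflTransGen (R S) G H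

lemma T_symm {S : Finset (Fin n)} {G H : SimpleGraph (Fin n)} (h : T S G H) : T S H G := by
  induction h with
  | refl => exact Relation.ReflTransGen.refl
  | tail _ h ih => exact Relation.ReflTransGen.head ⟨switch_symm h.1, h.2.2, h.2.1⟩ ih

lemma T_card {S : Finset (Fin n)} {G H : SimpleGraph (Fin n)} (h : T S G H) (j : Fin n) :
    (nb H j).card = (nb G j).card := by
  induction h with
  | refl => rfl
  | tail _ h ih => rw [switch_card h.1, ih]

lemma T_supp {S S' : Finset (Fin n)} {G H : SimpleGraph (Fin n)} (h : T S G H)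
    (hS : Supp S' G) : Supp S' H := by
  induction h with
  | refl => exact hS
  | tail _ h ih => exact switch_supp h.1 ih

lemma T_conn {S : Finset (Fin n)} {G H : SimpleGraph (Fin n)} (h : T S G H)
    (hS : ConnOn S G) : ConnOn S H := by
  induction h with
  | refl => exact hS
  | tail _ h ih => exact h.2.2

/-- Induction principle for reachability. -/
lemma reach_ind {G : SimpleGraph (Fin n)} {x : Fin n} {P : Fin n → Prop} (h0 : P x)
    (hs : ∀ p q, G.Reachable x p → G.Adj p q → P p → P q) {y : Fin n} (h : G.Reachable x y) :
    P y := by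
  rw [SimpleGraph.reachable_iff_reflTransGen] at h
  induction h with
  | refl => exact h0
  | tail h1 h2 ih => exact hs _ _ ((SimpleGraph.reachable_iff_reflTransGen _ _).2 h1) h2 ih

lemma reach_map {K L : SimpleGraph (Fin n)} (h : ∀ p q, K.Adj p q → L.Reachable p q)
    {x y : Fin n} (hxy : K.Reachable x y) : L.Reachable x y :=
  reach_ind (P := fun y => L.Reachable x y) (SimpleGraph.Reachable.refl x)
    (fun p q _ hpq ih => ih.trans (h p q hpq)) hxy

/-- Attach `v` to the set `N`. -/
def att (K : SimpleGraph (Fin n)) (v : Fin n) (N : Finset (Fin n)) : SimpleGraph (Fin n) where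
  Adj x y := K.Adj x y ∨ (x = v ∧ y ∈ N ∧ y ≠ v) ∨ (y = v ∧ x ∈ N ∧ x ≠ v)
  symm := ⟨fun x y h => by rw [K.adj_comm y x]; tauto⟩
  loopless := ⟨fun x h => by
    have := K.irrefl (v := x)
    tauto⟩

lemma att_del (G : SimpleGraph (Fin n)) (v : Fin n) : att (del G v) v (nb G v) = G := by
  ext x y
  simp only [att, del, mem_nb]
  have := G.adj_comm x y
  have := G.irrefl (v := v)
  grind

lemma conn_att {S : Finset (Fin n)} {v : Fin n} {N : Finset (Fin n)} {K : SimpleGraph (Fin n)}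
    (hN : ∃ u ∈ N, u ∈ S.erase v) (h : ConnOn (S.erase v) K) :
    ConnOn S (att K v N) := by
  obtain ⟨u, huN, huS⟩ := hN
  have key : ∀ x ∈ S, (att K v N).Reachable u x := by
    intro x hx
    by_cases hxv : x = v
    · subst hxv
      refine SimpleGraph.Adj.reachable ?_
      exact Or.inr (Or.inr ⟨rfl, huN, (Finset.mem_erase.1 huS).1⟩)
    · exact (h u huS x (Finset.mem_erase.2 ⟨hxv, hx⟩)).mono (fun _ _ h => Or.inl h)
  intro x hx y hy
  exact (key x hx).symm.trans (key y hy)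

lemma R_att {S : Finset (Fin n)} {v : Fin n} {N : Finset (Fin n)} {K L : SimpleGraph (Fin n)}
    (hN : ∃ u ∈ N, u ∈ S.erase v) (hK : Supp (S.erase v) K)
    (h : R (S.erase v) K L) : R S (att K v N) (att L v N) := by
  refine ⟨?_, conn_att hN h.2.1, conn_att hN h.2.2⟩
  have h1 := h.1
  rw [switch_iff] at h1 ⊢
  obtain ⟨a, b, c, d, hab, hac, had, hbc, hbd, hcd, e1, e2, e3, e4, h⟩ := h1
  have va := (Finset.mem_erase.1 (hK _ _ e1)).1
  have vb := (Finset.mem_erase.1 (hK _ _ e1.symm)).1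
  have vc := (Finset.mem_erase.1 (hK _ _ e2)).1
  have vd := (Finset.mem_erase.1 (hK _ _ e2.symm)).1
  refine ⟨a, b, c, d, hab, hac, had, hbc, hbd, hcd, Or.inl e1, Or.inl e2, ?_, ?_, ?_⟩
  · simp only [att]; tauto
  · simp only [att]; tauto
  · intro x y
    simp only [att, SwAdj, h]
    grind

lemma T_att {S : Finset (Fin n)} {v : Fin n} {N : Finset (Fin n)} {K L : SimpleGraph (Fin n)}
    (hN : ∃ u ∈ N, u ∈ S.erase v) (hK : Supp (S.erase v) K)
    (h : T (S.erase v) K L) : T S (att K v N) (att L v N) := by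
  induction h with
  | refl => exact Relation.ReflTransGen.refl
  | tail h1 h2 ih => exact ih.tail (R_att hN (T_supp h1 hK) h2)

lemma supp_del {S : Finset (Fin n)} {G : SimpleGraph (Fin n)} (v : Fin n) (h : Supp S G) :
    Supp (S.erase v) (del G v) :=
  fun x y hxy => Finset.mem_erase.2 ⟨hxy.2.1, h x y hxy.1⟩

lemma conn_of_del {S : Finset (Fin n)} {G : SimpleGraph (Fin n)} {v : Fin n} (h : Supp S G)
    (hc : ConnOn (S.erase v) (del G v)) (hv : (nb G v).Nonempty) : ConnOn S G := by
  rw [← att_del G v]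
  obtain ⟨u, hu⟩ := hv
  have hu' := (mem_nb ..).1 hu
  exact conn_att ⟨u, hu, Finset.mem_erase.2 ⟨hu'.ne', h _ _ hu'.symm⟩⟩ hc

/-- The choice of the vertex `x` in the move lemma. -/
lemma exists_x {S : Finset (Fin n)} {G : SimpleGraph (Fin n)} {v u w : Fin n}
    (hc : ConnOn (S.erase v) (del G v)) (hS : Supp S G)
    (hu : u ∈ S.erase v) (hvu : ¬ G.Adj v u) (hvw : G.Adj v w)
    (hd : (nb G w).card ≤ (nb G u).card) :
    ∃ x, G.Adj u x ∧ x ≠ w ∧ ¬ G.Adj w x ∧ (rem (del G v) u x).Reachable u w := by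
  have huv : u ≠ v := (Finset.mem_erase.1 hu).1
  have huw : u ≠ w := by rintro rfl; exact hvu hvw
  have hwv : w ≠ v := hvw.ne'
  have hw : w ∈ S.erase v := Finset.mem_erase.2 ⟨hwv, hS _ _ hvw.symm⟩
  have hex : ∃ x, G.Adj u x ∧ x ≠ w ∧ ¬ G.Adj w x := by
    by_contra hcon
    push Not at hcon
    by_cases hadj : G.Adj u w
    · have hsub : insert v (insert u ((nb G u).erase w)) ⊆ nb G w := by
        intro x hx
        simp only [Finset.mem_insert, Finset.mem_erase, mem_nb] at hx ⊢
        rcases hx with rfl | rfl | ⟨h1, h2⟩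
        · exact hvw.symm
        · exact hadj.symm
        · exact hcon x h2 h1
      have := Finset.card_le_card hsub
      rw [Finset.card_insert_of_notMem, Finset.card_insert_of_notMem,
        Finset.card_erase_of_mem ((mem_nb ..).2 hadj)] at this
      · omega
      · simp [mem_nb]
      · have := fun h : G.Adj u v => hvu h.symm
        simp only [Finset.mem_insert, Finset.mem_erase, mem_nb]
        grind
    · have hsub : insert v (nb G u) ⊆ nb G w := by
        intro x hx
        simp only [Finset.mem_insert, mem_nb] at hx ⊢
        rcases hx with rfl | h2
        · exact hvw.symm
        · refine hcon x h2 ?_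
          rintro rfl
          exact hadj h2
      have := Finset.card_le_card hsub
      rw [Finset.card_insert_of_notMem] at this
      · omega
      · have := fun h : G.Adj u v => hvu h.symm
        rw [mem_nb]
        exact this
  by_cases hadj : G.Adj u w
  · obtain ⟨x, h1, h2, h3⟩ := hex
    refine ⟨x, h1, h2, h3, SimpleGraph.Adj.reachable ?_⟩
    refine ⟨⟨hadj, huv, hwv⟩, ?_, ?_⟩
    · exact fun h => h2 h.2.symm
    · exact fun h => huw h.2.symm
  by_cases hz : ∃ z, G.Adj u z ∧ G.Adj w z
  · obtain ⟨x, h1, h2, h3⟩ := hex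
    obtain ⟨z, hz1, hz2⟩ := hz
    have hzv : z ≠ v := by rintro rfl; exact hvu hz1.symm
    have hzx : z ≠ x := by rintro rfl; exact h3 hz2
    refine ⟨x, h1, h2, h3, ?_⟩
    have r1 : (rem (del G v) u x).Adj u z := by
      refine ⟨⟨hz1, huv, hzv⟩, ?_, ?_⟩
      · exact fun h => hzx h.2
      · exact fun h => hz1.ne h.2.symm
    have r2 : (rem (del G v) u x).Adj z w := by
      refine ⟨⟨hz2.symm, hzv, hwv⟩, ?_, ?_⟩
      · exact fun h => hz1.ne h.1.symm
      · exact fun h => huw h.2.symm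
    exact r1.reachable.trans r2.reachable
  push Not at hz
  -- `w` has a neighbour other than `v`
  have hw2 : 2 ≤ (nb G w).card := by
    have hr := hc w hw u hu
    rw [SimpleGraph.reachable_iff_reflTransGen] at hr
    obtain h | ⟨y, hy, -⟩ := Relation.ReflTransGen.cases_head hr
    · exact absurd h.symm huw
    · have : 1 < (nb G w).card :=
        Finset.one_lt_card.2 ⟨y, (mem_nb ..).2 hy.1, v, (mem_nb ..).2 hvw.symm, hy.2.2⟩
      omega
  obtain ⟨x1, hx1, x2, hx2, hne⟩ := Finset.one_lt_card.1 (show 1 < (nb G u).card by omega)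
  rw [mem_nb] at hx1 hx2
  have hv1 : x1 ≠ v := by rintro rfl; exact hvu hx1.symm
  have hv2 : x2 ≠ v := by rintro rfl; exact hvu hx2.symm
  have hor : (rem (del G v) u x1).Reachable u w ∨ (rem (del G v) u x2).Reachable u w := by
    refine reach_ind (G := del G v) (x := u)
      (P := fun p => (rem (del G v) u x1).Reachable u p ∨ (rem (del G v) u x2).Reachable u p)
      (Or.inl (SimpleGraph.Reachable.refl u)) ?_ (hc u hu w hw)
    have aux : ∀ y1 y2 : Fin n, y1 ≠ y2 → G.Adj u y1 → y1 ≠ v → ∀ p q, (del G v).Adj p q →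
        (rem (del G v) u y1).Reachable u p →
        (rem (del G v) u y1).Reachable u q ∨ (rem (del G v) u y2).Reachable u q := by
      intro y1 y2 hy hu1 hyv p q hpq hr
      by_cases hq : q = u
      · subst hq; exact Or.inl (SimpleGraph.Reachable.refl _)
      by_cases hq1 : p = u ∧ q = y1
      · right
        rw [hq1.2]
        refine SimpleGraph.Adj.reachable ⟨⟨hu1, huv, hyv⟩, ?_, ?_⟩
        · exact fun h => hy h.2
        · exact fun h => hu1.ne h.2.symm
      · left
        refine hr.trans (SimpleGraph.Adj.reachable ⟨hpq, hq1, fun h => hq h.2⟩)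
    intro p q _ hpq hP
    rcases hP with h | h
    · exact aux x1 x2 hne hx1 hv1 p q hpq h
    · exact (aux x2 x1 hne.symm hx2 hv2 p q hpq h).symm
  rcases hor with h | h
  · exact ⟨x1, hx1, fun h => hadj (h ▸ hx1), hz x1 hx1, h⟩
  · exact ⟨x2, hx2, fun h => hadj (h ▸ hx2), hz x2 hx2, h⟩

lemma move {S : Finset (Fin n)} {G : SimpleGraph (Fin n)} {v u w : Fin n}
    (hc : ConnOn (S.erase v) (del G v)) (hS : Supp S G)
    (hu : u ∈ S.erase v) (hvu : ¬ G.Adj v u) (hvw : G.Adj v w)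
    (hd : (nb G w).card ≤ (nb G u).card) :
    ∃ H, T S G H ∧ ConnOn (S.erase v) (del H v) ∧ nb H v = insert u ((nb G v).erase w) := by
  obtain ⟨x, hux, hxw, hwx, hr⟩ := exists_x hc hS hu hvu hvw hd
  have huv : u ≠ v := (Finset.mem_erase.1 hu).1
  have huw : u ≠ w := by rintro rfl; exact hvu hvw
  have hwv : w ≠ v := hvw.ne'
  have hxv : x ≠ v := by rintro rfl; exact hvu hux.symm
  have hxu : x ≠ u := hux.ne'
  have hadj : ∀ p q, (sw G v w u x huv.symm hxw.symm).Adj p q ↔ SwAdj G v w u x p q :=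
    fun _ _ => Iff.rfl
  generalize sw G v w u x huv.symm hxw.symm = H at hadj
  have hsw : SwitchMove G H := by
    rw [switch_iff]
    exact ⟨v, w, u, x, hwv.symm, huv.symm, hxv.symm, huw.symm, hxw.symm, hux.ne, hvw, hux, hvu,
      hwx, hadj⟩
  have hnb : nb H v = insert u ((nb G v).erase w) := by
    ext y
    simp only [mem_nb, Finset.mem_insert, Finset.mem_erase, hadj, SwAdj]
    grind
  have hrem : ∀ p q, (rem (del G v) u x).Adj p q → (del H v).Adj p q := by
    intro p q h
    simp only [rem_adj, del_adj, hadj, SwAdj] at h ⊢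
    grind
  have hcH : ConnOn (S.erase v) (del H v) := by
    have hux' : (del H v).Reachable u x := by
      have h1 : (del H v).Reachable u w := hr.mono (fun p q h => hrem p q h)
      refine h1.trans (SimpleGraph.Adj.reachable ?_)
      simp only [del_adj, hadj, SwAdj]
      grind
    intro p hp q hq
    refine reach_map ?_ (hc p hp q hq)
    intro p q hpq
    by_cases h1 : p = u ∧ q = x
    · rw [h1.1, h1.2]; exact hux'
    by_cases h2 : p = x ∧ q = u
    · rw [h2.1, h2.2]; exact hux'.symm
    exact (hrem p q ⟨hpq, h1, h2⟩).reachable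
  refine ⟨H, Relation.ReflTransGen.single ⟨hsw, conn_of_del hS hc ⟨w, (mem_nb ..).2 hvw⟩,
    conn_of_del (switch_supp hsw hS) hcH ⟨u, ?_⟩⟩, hcH, hnb⟩
  rw [hnb]
  exact Finset.mem_insert_self ..

lemma align {S : Finset (Fin n)} {v : Fin n} (m : ℕ) : ∀ G G' : SimpleGraph (Fin n),
    (nb G v \ nb G' v).card = m → Supp S G → Supp S G' →
    ConnOn (S.erase v) (del G v) → ConnOn (S.erase v) (del G' v) →
    (∀ j, (nb G j).card = (nb G' j).card) →
    ∃ H H', T S G H ∧ T S G' H' ∧ ConnOn (S.erase v) (del H v) ∧ ConnOn (S.erase v) (del H' v) ∧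
      nb H v = nb H' v := by
  induction m with
  | zero =>
    intro G G' hm hS hS' hc hc' hd
    refine ⟨G, G', Relation.ReflTransGen.refl, Relation.ReflTransGen.refl, hc, hc', ?_⟩
    rw [Finset.card_eq_zero, Finset.sdiff_eq_empty_iff_subset] at hm
    exact Finset.eq_of_subset_of_card_le hm (hd v).ge
  | succ m ih =>
    intro G G' hm hS hS' hc hc' hd
    have hm' : (nb G' v \ nb G v).card = m + 1 := by
      rw [← hm]; exact (Finset.card_sdiff_comm (hd v)).symm
    obtain ⟨w, hw⟩ := Finset.card_pos.1 (show 0 < (nb G v \ nb G' v).card by omega)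
    obtain ⟨u, hu⟩ := Finset.card_pos.1 (show 0 < (nb G' v \ nb G v).card by omega)
    have hw0 := hw
    have hu0 := hu
    simp only [Finset.mem_sdiff, mem_nb] at hw hu
    have huS : u ∈ S.erase v := Finset.mem_erase.2 ⟨hu.1.ne', hS' _ _ hu.1.symm⟩
    have hwS : w ∈ S.erase v := Finset.mem_erase.2 ⟨hw.1.ne', hS _ _ hw.1.symm⟩
    rcases le_total (nb G w).card (nb G u).card with hle | hle
    · obtain ⟨H, hT, hH, hnb⟩ := move hc hS huS hu.2 hw.1 hle
      obtain ⟨H1, H2, a1, a2, a3⟩ := ih H G' (by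
        have : nb H v \ nb G' v = (nb G v \ nb G' v).erase w := by
          rw [hnb]; ext y
          simp only [Finset.mem_sdiff, Finset.mem_insert, Finset.mem_erase, mem_nb]
          grind
        rw [this, Finset.card_erase_of_mem hw0, hm]; rfl) (T_supp hT hS) hS' hH hc'
        (fun j => by rw [T_card hT, hd])
      exact ⟨H1, H2, hT.trans a1, a2, a3⟩
    · rw [hd, hd] at hle
      obtain ⟨H, hT, hH, hnb⟩ := move hc' hS' hwS hw.2 hu.1 hle
      obtain ⟨H1, H2, a1, a2, a3⟩ := ih G H (by
        have : nb G v \ nb H v = (nb G v \ nb G' v).erase w := by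
          rw [hnb]; ext y
          simp only [Finset.mem_sdiff, Finset.mem_insert, Finset.mem_erase, mem_nb]
          grind
        rw [this, Finset.card_erase_of_mem hw0, hm]; rfl) hS (T_supp hT hS') hc hH
        (fun j => by rw [T_card hT, hd])
      exact ⟨H1, H2, a1, hT.trans a2, a3⟩

lemma nb_del {G : SimpleGraph (Fin n)} {v w : Fin n} (hw : w ≠ v) :
    nb (del G v) w = (nb G w).erase v := by
  ext x
  simp only [mem_nb, del_adj, Finset.mem_erase]
  tauto

/-- A non-bridge exists. -/
lemma exists_nonbridge {S : Finset (Fin n)} {G : SimpleGraph (Fin n)} {v : Fin n}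
    (hS : Supp S G) (hv2 : 2 ≤ (nb G v).card) (hmin : ∀ w ∈ S, (nb G v).card ≤ (nb G w).card)
    {p q : Fin n} (hp : p ∈ S.erase v) (hq : q ∈ S.erase v) (hpq : ¬ (del G v).Reachable p q) :
    ∃ x y, (del G v).Adj x y ∧ (rem (del G v) x y).Reachable x y := by
  by_contra hcon
  push Not at hcon
  set K := del G v with hK
  have hac : K.IsAcyclic := by
    rw [SimpleGraph.isAcyclic_iff_forall_adj_isBridge]
    intro x y hxy
    rw [SimpleGraph.isBridge_iff]
    intro hr
    refine hcon x y hxy (hr.mono ?_)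
    intro a b hab
    simp only [SimpleGraph.deleteEdges_adj, Set.mem_singleton_iff, Sym2.eq_iff] at hab
    exact ⟨hab.1, by tauto, by tauto⟩
  set S' := S.erase v with hS'
  let V := {x // x ∈ S'}
  let K' : SimpleGraph V := K.comap (fun x : V => x.1)
  have hac' : K'.IsAcyclic := hac.of_comap (Function.Embedding.subtype _)
  have hpq' : ¬ K'.Reachable ⟨p, hp⟩ ⟨q, hq⟩ := by
    intro h
    exact hpq (h.map (⟨fun x => x.1, fun h => h⟩ : K' →g K))
  have hac2 := SimpleGraph.IsAcyclic.sup_edge_of_not_reachable hpq' hac'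
  obtain ⟨F, hF1, hF2⟩ := SimpleGraph.exists_maximal_isAcyclic_of_le_isAcyclic (G := ⊤) le_top hac2
  have : Nonempty V := ⟨⟨p, hp⟩⟩
  have hF3 : F.IsTree := by
    rw [SimpleGraph.isTree_iff_maximal_isAcyclic]
    refine ⟨this, ?_⟩
    simpa using hF2
  have hcard := hF3.card_edgeFinset
  have hsum := F.sum_degrees_eq_twice_card_edges
  have hdeg : ∀ (w : V) (A : Finset (Fin n)),
      (∀ x ∈ A, ∃ h : x ∈ S', F.Adj w ⟨x, h⟩) → A.card ≤ F.degree w := by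
    intro w A hA
    rw [← SimpleGraph.card_neighborFinset_eq_degree,
      ← Finset.card_map (Function.Embedding.subtype (fun x => x ∈ S'))]
    refine Finset.card_le_card ?_
    intro x hx
    obtain ⟨h, hx'⟩ := hA x hx
    rw [Finset.mem_map]
    exact ⟨⟨x, h⟩, (SimpleGraph.mem_neighborFinset ..).2 hx', rfl⟩
  have hKS : ∀ w x, K.Adj w x → x ∈ S' := fun w x h => supp_del v hS _ _ h.symm
  have hKF : ∀ (w : V) (x : Fin n) (h : K.Adj w.1 x), F.Adj w ⟨x, hKS _ _ h⟩ := by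
    intro w x h
    exact hF1 (Or.inl h)
  have hle : ∀ w : V, (nb K w.1).card ≤ F.degree w := by
    intro w
    refine hdeg w _ fun x hx => ?_
    rw [mem_nb] at hx
    exact ⟨hKS _ _ hx, hKF w x hx⟩
  have hlt : (nb K p).card < F.degree ⟨p, hp⟩ := by
    have hqn : q ∉ nb K p := by
      rw [mem_nb]
      exact fun h => hpq h.reachable
    have h1 := hdeg ⟨p, hp⟩ (insert q (nb K p)) (by
      intro x hx
      rw [Finset.mem_insert] at hx
      rcases hx with rfl | hx
      · refine ⟨hq, hF1 (Or.inr ?_)⟩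
        rw [SimpleGraph.edge_adj]
        refine ⟨Or.inl ⟨rfl, rfl⟩, ?_⟩
        intro h
        apply hpq
        rw [Subtype.mk.injEq] at h
        rw [h]
      · rw [mem_nb] at hx
        exact ⟨hKS _ _ hx, hKF ⟨p, hp⟩ x hx⟩)
    rw [Finset.card_insert_of_notMem hqn] at h1
    omega
  have hs1 : ∑ w : V, (nb K w.1).card < ∑ w : V, F.degree w :=
    Finset.sum_lt_sum (fun w _ => hle w) ⟨⟨p, hp⟩, Finset.mem_univ _, hlt⟩
  have hs2 : ∑ w : V, (nb K w.1).card = ∑ w ∈ S', (nb K w).card :=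
    Finset.sum_coe_sort S' (fun w => (nb K w).card)
  have hcV : Fintype.card V = S'.card := Fintype.card_coe S'
  have hnS : nb G v ⊆ S' := by
    intro x hx
    rw [mem_nb] at hx
    exact Finset.mem_erase.2 ⟨hx.ne', hS _ _ hx.symm⟩
  have hs3 : ∑ w ∈ S', (nb G v).card ≤ ∑ w ∈ S', ((nb K w).card + if w ∈ nb G v then 1 else 0) := by
    refine Finset.sum_le_sum fun w hw => ?_
    have hw' := Finset.mem_erase.1 hw
    have h1 := hmin w hw'.2
    rw [hK, nb_del hw'.1]
    split_ifs with h
    · rw [mem_nb] at h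
      rw [Finset.card_erase_of_mem ((mem_nb ..).2 h.symm)]
      omega
    · rw [mem_nb] at h
      rw [Finset.erase_eq_of_notMem (fun h' => h ((mem_nb ..).1 h').symm)]
      omega
  rw [Finset.sum_add_distrib, Finset.sum_const, smul_eq_mul, Finset.sum_ite_mem,
    Finset.inter_eq_right.2 hnS, Finset.sum_const, smul_eq_mul, mul_one] at hs3
  have hpos : 0 < S'.card := Finset.card_pos.2 ⟨p, hp⟩
  obtain ⟨s, hs⟩ := Nat.exists_eq_succ_of_ne_zero hpos.ne'
  obtain ⟨δ, hδ⟩ := Nat.exists_eq_add_of_le hv2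
  have : F.edgeFinset.card = s := by omega
  rw [hs2, hsum, this] at hs1
  rw [hs, hδ] at hs3
  nlinarith [Nat.zero_le (δ * s)]

lemma conn_del_leaf {S : Finset (Fin n)} {G : SimpleGraph (Fin n)} {v : Fin n}
    (hc : ConnOn S G) (hS : Supp S G) (hv : (nb G v).card = 1) :
    ConnOn (S.erase v) (del G v) := by
  obtain ⟨u, hu⟩ := Finset.card_eq_one.1 hv
  have hu' : ∀ x, G.Adj v x ↔ x = u := by
    intro x
    rw [← mem_nb, hu, Finset.mem_singleton]
  have hvu : G.Adj v u := (hu' u).2 rfl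
  have huS : u ∈ S := hS _ _ hvu.symm
  have key : ∀ x ∈ S.erase v, (del G v).Reachable u x := by
    intro x hx
    have hx' := Finset.mem_erase.1 hx
    refine reach_ind (G := G) (x := u) (P := fun p => p ≠ v → (del G v).Reachable u p)
      (fun _ => SimpleGraph.Reachable.refl u) ?_ (hc u huS x hx'.2) hx'.1
    intro p q _ hpq ih hq
    by_cases hp : p = v
    · subst hp
      rw [(hu' q).1 hpq]
    · exact (ih hp).trans (SimpleGraph.Adj.reachable ⟨hpq, hp, hq⟩)
  intro x hx y hy
  exact (key x hx).symm.trans (key y hy)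

/-- Merging two components of `G - v`. -/
lemma merge {S : Finset (Fin n)} {G : SimpleGraph (Fin n)} {v : Fin n}
    (hc : ConnOn S G) (hS : Supp S G)
    (hv2 : 2 ≤ (nb G v).card) (hmin : ∀ w ∈ S, (nb G v).card ≤ (nb G w).card)
    (hn : ¬ ConnOn (S.erase v) (del G v)) :
    ∃ H, T S G H ∧ (∀ p q, (del G v).Reachable p q → (del H v).Reachable p q) ∧
      ∃ p q, ¬ (del G v).Reachable p q ∧ (del H v).Reachable p q := by
  unfold ConnOn at hn
  push Not at hn
  obtain ⟨p, hp, q, hq, hpq⟩ := hn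
  obtain ⟨x, y, hxy, hrxy⟩ := exists_nonbridge hS hv2 hmin hp hq hpq
  have hz : ∃ z ∈ S.erase v, ¬ (del G v).Reachable x z := by
    by_contra hcon
    push Not at hcon
    exact hpq ((hcon p hp).symm.trans (hcon q hq))
  obtain ⟨z, hzS, hxz⟩ := hz
  have hz' := Finset.mem_erase.1 hzS
  have ht : ∃ t, (del G v).Adj z t := by
    have h1 := hmin z hz'.2
    have h2 : 0 < (nb (del G v) z).card := by
      rw [nb_del hz'.1]
      have := Finset.pred_card_le_card_erase (s := nb G z) (a := v)
      omega
    obtain ⟨t, ht⟩ := Finset.card_pos.1 h2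
    exact ⟨t, (mem_nb ..).1 ht⟩
  obtain ⟨t, hzt⟩ := ht
  have hxt : ¬ (del G v).Reachable x t := fun h => hxz (h.trans hzt.symm.reachable)
  have hyz : ¬ (del G v).Reachable y z := fun h => hxz (hxy.reachable.trans h)
  have hyt : ¬ (del G v).Reachable y t := fun h => hxt (hxy.reachable.trans h)
  have nxz : x ≠ z := by rintro rfl; exact hxz (SimpleGraph.Reachable.refl _)
  have nxt : x ≠ t := by rintro rfl; exact hxt (SimpleGraph.Reachable.refl _)
  have nyz : y ≠ z := by rintro rfl; exact hyz (SimpleGraph.Reachable.refl _)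
  have nyt : y ≠ t := by rintro rfl; exact hyt (SimpleGraph.Reachable.refl _)
  have nxy := hxy.ne
  have nzt := hzt.ne
  have vx : x ≠ v := hxy.2.1
  have vy : y ≠ v := hxy.2.2
  have vz : z ≠ v := hzt.2.1
  have vt : t ≠ v := hzt.2.2
  have axz : ¬ G.Adj x z := fun h => hxz (SimpleGraph.Adj.reachable ⟨h, vx, vz⟩)
  have ayt : ¬ G.Adj y t := fun h => hyt (SimpleGraph.Adj.reachable ⟨h, vy, vt⟩)
  have hadj : ∀ p q, (sw G x y z t nxz nyt).Adj p q ↔ SwAdj G x y z t p q :=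
    fun _ _ => Iff.rfl
  generalize sw G x y z t nxz nyt = H at hadj
  have hsw : SwitchMove G H := by
    rw [switch_iff]
    exact ⟨x, y, z, t, nxy, nxz, nxt, nyz, nyt, nzt, hxy.1, hzt.1, axz, ayt, hadj⟩
  have hkeep : ∀ p q, (del G v).Adj p q → ¬ (p = x ∧ q = y) → ¬ (p = y ∧ q = x) →
      ¬ (p = z ∧ q = t) → ¬ (p = t ∧ q = z) → (del H v).Adj p q := by
    intro p q h h1 h2 h3 h4
    exact ⟨(hadj p q).2 (Or.inl ⟨h.1, h1, h2, h3, h4⟩), h.2⟩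
  have bxz : (del H v).Adj x z := ⟨(hadj _ _).2 (by unfold SwAdj; tauto), vx, vz⟩
  have byt : (del H v).Adj y t := ⟨(hadj _ _).2 (by unfold SwAdj; tauto), vy, vt⟩
  have rxy : (del H v).Reachable x y := by
    refine reach_ind (G := rem (del G v) x y) (x := x) (P := fun p => (del H v).Reachable x p)
      (SimpleGraph.Reachable.refl x) ?_ hrxy
    intro a b ha hab ih
    have ha' : (del G v).Reachable x a := reach_map (K := rem (del G v) x y) (fun _ _ h => SimpleGraph.Adj.reachable h.1) ha
    refine ih.trans (SimpleGraph.Adj.reachable (hkeep a b hab.1 hab.2.1 hab.2.2 ?_ ?_))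
    · rintro ⟨rfl, -⟩; exact hxz ha'
    · rintro ⟨rfl, -⟩; exact hxt ha'
  have rzt : (del H v).Reachable z t := bxz.symm.reachable.trans (rxy.trans byt.reachable)
  have hpres1 : ∀ a b, (del G v).Adj a b → (del H v).Reachable a b := by
    intro a b hab
    by_cases h1 : a = x ∧ b = y
    · rw [h1.1, h1.2]; exact rxy
    by_cases h2 : a = y ∧ b = x
    · rw [h2.1, h2.2]; exact rxy.symm
    by_cases h3 : a = z ∧ b = t
    · rw [h3.1, h3.2]; exact rzt
    by_cases h4 : a = t ∧ b = z
    · rw [h4.1, h4.2]; exact rzt.symm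
    exact (hkeep a b hab h1 h2 h3 h4).reachable
  have hcH : ConnOn S H := by
    intro a ha b hb
    refine reach_map ?_ (hc a ha b hb)
    intro a b hab
    by_cases hv : a ≠ v ∧ b ≠ v
    · exact reach_map (K := del H v) (fun _ _ h => SimpleGraph.Adj.reachable h.1) (hpres1 a b ⟨hab, hv⟩)
    · refine SimpleGraph.Adj.reachable ((hadj a b).2 (Or.inl ?_))
      grind
  exact ⟨H, Relation.ReflTransGen.single ⟨hsw, hc, hcH⟩, fun a b h => reach_map hpres1 h,
    x, z, hxz, bxz.reachable⟩

lemma make_conn {S : Finset (Fin n)} {v : Fin n} (hvS : v ∈ S) (m : ℕ) :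
    ∀ G : SimpleGraph (Fin n), 
    (Finset.univ.filter (fun e : Fin n × Fin n => ¬ (del G v).Reachable e.1 e.2)).card ≤ m →
    ConnOn S G → Supp S G → 1 ≤ (nb G v).card → (∀ w ∈ S, (nb G v).card ≤ (nb G w).card) →
    ∃ H, T S G H ∧ ConnOn (S.erase v) (del H v) := by
  induction m with
  | zero =>
    intro G hm hc hS h1 hmin
    refine ⟨G, Relation.ReflTransGen.refl, ?_⟩
    intro x _ y _
    by_contra hcon
    have : (x, y) ∈ Finset.univ.filter
        (fun e : Fin n × Fin n => ¬ (del G v).Reachable e.1 e.2) := by simpa using hcon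
    have := Finset.card_pos.2 ⟨_, this⟩
    omega
  | succ m ih =>
    intro G hm hc hS h1 hmin
    by_cases hn : ConnOn (S.erase v) (del G v)
    · exact ⟨G, Relation.ReflTransGen.refl, hn⟩
    by_cases h1' : (nb G v).card = 1
    · exact absurd (conn_del_leaf hc hS h1') hn
    obtain ⟨H, hT, hpres, a, b, hab, hab'⟩ := merge hc hS (by omega) hmin hn
    have hlt : (Finset.univ.filter
        (fun e : Fin n × Fin n => ¬ (del H v).Reachable e.1 e.2)).card <
        (Finset.univ.filter
        (fun e : Fin n × Fin n => ¬ (del G v).Reachable e.1 e.2)).card := by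
      refine Finset.card_lt_card ?_
      rw [Finset.ssubset_iff_of_subset]
      · refine ⟨(a, b), ?_, ?_⟩
        · simpa using hab
        · simpa using hab'
      · intro e he
        simp only [Finset.mem_filter, Finset.mem_univ, true_and] at he ⊢
        exact fun h => he (hpres _ _ h)
    obtain ⟨H', hT', hc'⟩ := ih H (by omega) (T_conn hT hc) (T_supp hT hS)
      (by rw [T_card hT]; exact h1) (fun w hw => by rw [T_card hT, T_card hT]; exact hmin w hw)
    exact ⟨H', hT.trans hT', hc'⟩

lemma main (m : ℕ) : ∀ (S : Finset (Fin n)) (G G' : SimpleGraph (Fin n)), S.card = m →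
    Supp S G → Supp S G' → ConnOn S G → ConnOn S G' →
    (∀ j, (nb G j).card = (nb G' j).card) → T S G G' := by
  induction m with
  | zero =>
    intro S G G' hm hS hS' _ _ _
    rw [Finset.card_eq_zero] at hm
    subst hm
    have h1 : G = G' := by
      ext x y
      constructor
      · intro h; exact absurd (hS _ _ h) (Finset.notMem_empty _)
      · intro h; exact absurd (hS' _ _ h) (Finset.notMem_empty _)
    rw [h1]
    exact Relation.ReflTransGen.refl
  | succ m ih =>
    intro S G G' hm hS hS' hc hc' hd
    have hne : S.Nonempty := Finset.card_pos.1 (by omega)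
    obtain ⟨v, hvS, hmin⟩ := Finset.exists_min_image S (fun w => (nb G w).card) hne
    by_cases hv0 : (nb G v).card = 0
    · have aux : ∀ A B : SimpleGraph (Fin n), Supp S A → ConnOn S A → (nb A v).card = 0 →
          ∀ x y, A.Adj x y → B.Adj x y := by
        intro A B hA hcA h0 x y hxy
        exfalso
        have hx : ∀ z ∈ S, z = v := by
          intro z hz
          have hr := hcA v hvS z hz
          rw [SimpleGraph.reachable_iff_reflTransGen] at hr
          obtain h | ⟨w, hw, -⟩ := Relation.ReflTransGen.cases_head hr
          · exact h.symm
          · have := Finset.card_pos.2 ⟨w, (mem_nb ..).2 hw⟩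
            omega
        exact hxy.ne ((hx x (hA _ _ hxy)).trans (hx y (hA _ _ hxy.symm)).symm)
      have h1 : G = G' := by
        ext x y
        exact ⟨aux G G' hS hc hv0 x y, aux G' G hS' hc' (by rw [← hd]; exact hv0) x y⟩
      rw [h1]
      exact Relation.ReflTransGen.refl
    obtain ⟨H, hT, hH⟩ := make_conn hvS _ G le_rfl hc hS (by omega) hmin
    obtain ⟨H', hT', hH'⟩ := make_conn hvS _ G' le_rfl hc' hS' (by rw [← hd]; omega)
      (fun w hw => by rw [← hd, ← hd]; exact hmin w hw)
    obtain ⟨L, L', hL, hL', cL, cL', hnb⟩ := align _ H H' rfl (T_supp hT hS) (T_supp hT' hS') hH hH'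
      (fun j => by rw [T_card hT, T_card hT', hd])
    have hGL : T S G L := hT.trans hL
    have hGL' : T S G' L' := hT'.trans hL'
    have sL := T_supp hGL hS
    have sL' := T_supp hGL' hS'
    have hK := ih (S.erase v) (del L v) (del L' v) (by rw [Finset.card_erase_of_mem hvS, hm]; rfl)
      (supp_del v sL) (supp_del v sL') cL cL' (by
        intro j
        by_cases hj : j = v
        · have h0 : ∀ A : SimpleGraph (Fin n), nb (del A v) v = ∅ := by
            intro A
            ext x
            simp [mem_nb, del_adj]
          rw [hj, h0, h0]
        · rw [nb_del hj, nb_del hj]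
          have e1 : (nb L j).card = (nb L' j).card := by rw [T_card hGL, T_card hGL', hd]
          have e2 : v ∈ nb L j ↔ v ∈ nb L' j := by
            rw [mem_nb, mem_nb, SimpleGraph.adj_comm, ← mem_nb, hnb, mem_nb, SimpleGraph.adj_comm]
          rw [Finset.card_erase_eq_ite, Finset.card_erase_eq_ite, e1]
          simp only [e2])
    have hnon : ∃ u ∈ nb L v, u ∈ S.erase v := by
      have : 0 < (nb L v).card := by rw [T_card hGL]; omega
      obtain ⟨u, hu⟩ := Finset.card_pos.1 this
      have hu' := (mem_nb ..).1 hu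
      exact ⟨u, hu, Finset.mem_erase.2 ⟨hu'.ne', sL _ _ hu'.symm⟩⟩
    have hlift := T_att (N := nb L v) hnon (supp_del v sL) hK
    rw [att_del] at hlift
    rw [hnb, att_del] at hlift
    exact (hGL.trans hlift).trans (T_symm hGL')

lemma seq {S : Finset (Fin n)} {G H : SimpleGraph (Fin n)} (h : T S G H) :
    ∃ m : ℕ, ∃ f : ℕ → SimpleGraph (Fin n), f 0 = G ∧ f m = H ∧
      (∀ i < m, SwitchMove (f i) (f (i + 1))) ∧ (∀ i ≤ m, T S G (f i)) := by
  induction h with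
  | refl => exact ⟨0, fun _ => G, rfl, rfl, by simp, fun i _ => Relation.ReflTransGen.refl⟩
  | @tail B C h1 h2 ih =>
    obtain ⟨m, f, h0, hm, hs, hT⟩ := ih
    refine ⟨m + 1, fun i => if i ≤ m then f i else C, ?_, ?_, ?_, ?_⟩
    · simpa using h0
    · simp
    · intro i hi
      by_cases him : i = m
      · subst him
        simpa [hm] using h2.1
      · have a1 : i ≤ m := by omega
        have a2 : i + 1 ≤ m := by omega
        simp only [a1, a2, if_true]
        exact hs i (by omega)
    · intro i hi
      by_cases him : i ≤ m
      · simp only [him, if_true]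
        exact hT i him
      · simp only [him, if_false]
        exact h1.tail h2

end Taylor

/-- **Taylor's theorem.** The set of connected simple graphs with a fixed graphical
degree sequence `k` is connected under switches preserving connectivity: for any two
connected graphs `G, G'` with degree sequence `k` there is a sequence of switches
transforming `G` into `G'` such that every intermediate graph is connected and has
degree sequence `k`. -/
theorem taylor_connected_switch_sequence (n : ℕ) (k : Fin n → ℕ)
    (G G' : SimpleGraph (Fin n))
    (hG : ∀ j, G.degree j = k j) (hG' : ∀ j, G'.degree j = k j)
    (hGc : G.Connected) (hG'c : G'.Connected) :
    ∃ m : ℕ, ∃ f : ℕ → SimpleGraph (Fin n), f 0 = G ∧ f m = G' ∧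
      (∀ i < m, SwitchMove (f i) (f (i + 1))) ∧
      (∀ i ≤ m, (f i).Connected ∧ ∀ j, (f i).degree j = k j) := by
  have hne : Nonempty (Fin n) := hGc.nonempty
  have hT : Taylor.T Finset.univ G G' := by
    refine Taylor.main _ Finset.univ G G' rfl (fun _ _ _ => Finset.mem_univ _)
      (fun _ _ _ => Finset.mem_univ _) (fun x _ y _ => hGc.preconnected x y)
      (fun x _ y _ => hG'c.preconnected x y) (fun j => ?_)
    rw [← Taylor.degree_eq, ← Taylor.degree_eq, hG, hG']
  obtain ⟨m, f, h0, hm, hs, hf⟩ := Taylor.seq hT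
  refine ⟨m, f, h0, hm, hs, fun i hi => ⟨⟨fun x y => ?_⟩, fun j => ?_⟩⟩
  · exact Taylor.T_conn (hf i hi) (fun x _ y _ => hGc.preconnected x y) x (Finset.mem_univ _) y
      (Finset.mem_univ _)
  · rw [← hG, Taylor.degree_eq, Taylor.degree_eq, Taylor.T_card (hf i hi)]
end
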